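/- Let n ≥ 2 and let U be a unitary n×n complex matrix all of whose entries belong to 𝔻[ω] = ℤ[1/√2, i], with det U = 1. Then U can be written as a finite product of two-level unitary matrices, each of type iX, of type T^(−m)(iH)T^m for some m ∈ ℤ, or of type W = diag(ω, ω^(−1)). -/

import Mathlib

noncomputable section

/-- The eighth root of unity `ω = e^{iπ/4} = (1+i)/√2`. -/
def ω : ℂ := (1 + Complex.I) / Real.sqrt 2

/-- A rational number is dyadic if it has the form `a / 2^n` with `a ∈ ℤ`, `n ∈ ℕ`. -/
def IsDyadic (q : ℚ) : Prop := ∃ (a : ℤ) (n : ℕ), q = a / 2 ^ n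

/-- Membership in the ring `𝔻[ω] = ℤ[1/√2, i]`: complex numbers of the form
`aω³ + bω² + cω + d` with `a, b, c, d` dyadic rationals. -/
def inDω (t : ℂ) : Prop :=
  ∃ a b c d : ℚ, IsDyadic a ∧ IsDyadic b ∧ IsDyadic c ∧ IsDyadic d ∧
    t = (a : ℂ) * ω ^ 3 + (b : ℂ) * ω ^ 2 + (c : ℂ) * ω + (d : ℂ)

/-- Membership in the ring `ℤ[ω]`: complex numbers of the form
`aω³ + bω² + cω + d` with `a, b, c, d ∈ ℤ`. -/
def inZω (t : ℂ) : Prop :=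
  ∃ a b c d : ℤ, t = (a : ℂ) * ω ^ 3 + (b : ℂ) * ω ^ 2 + (c : ℂ) * ω + (d : ℂ)

/-- The Hadamard gate. -/
def Hmat : Matrix (Fin 2) (Fin 2) ℂ := ((Real.sqrt 2 : ℂ))⁻¹ • !![1, 1; 1, -1]

/-- The phase gate `S`. -/
def Smat : Matrix (Fin 2) (Fin 2) ℂ := !![1, 0; 0, Complex.I]

/-- The `T` gate. -/
def Tmat : Matrix (Fin 2) (Fin 2) ℂ := !![1, 0; 0, ω]

/-- The `X` (not) gate. -/
def Xmat : Matrix (Fin 2) (Fin 2) ℂ := !![0, 1; 1, 0]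

/-- The controlled-not gate, as a matrix on two qubits: it sends `|a,b⟩` to `|a, a+b⟩`. -/
def CNOTmat : Matrix (Fin 2 × Fin 2) (Fin 2 × Fin 2) ℂ :=
  Matrix.of fun p q => if p.1 = q.1 ∧ p.2 = q.1 + q.2 then 1 else 0

/-- The one-level `n×n` matrix `a_[j]` of type `a`: the identity except that the `(j,j)`
entry is `a`. -/
def oneLevel {n : ℕ} (a : ℂ) (j : Fin n) : Matrix (Fin n) (Fin n) ℂ :=
  Matrix.of fun p q => if p = q then (if p = j then a else 1) else 0

/-- The two-level `n×n` matrix `U_[j,l]` of type `U`: the identity except that the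
`(j,j), (j,l), (l,j), (l,l)` entries are those of the `2×2` matrix `U`. -/
def twoLevel {n : ℕ} (U : Matrix (Fin 2) (Fin 2) ℂ) (j l : Fin n) :
    Matrix (Fin n) (Fin n) ℂ :=
  Matrix.of fun p q =>
    if p = j ∧ q = j then U 0 0
    else if p = j ∧ q = l then U 0 1
    else if p = l ∧ q = j then U 1 0
    else if p = l ∧ q = l then U 1 1
    else if p = q then 1 else 0

/-- A one- or two-level matrix of type `X`, `H`, `T` (two-level) or `ω` (one-level). -/
def IsLevelGen {n : ℕ} (M : Matrix (Fin n) (Fin n) ℂ) : Prop :=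
  (∃ j l : Fin n, j ≠ l ∧
      (M = twoLevel Xmat j l ∨ M = twoLevel Hmat j l ∨ M = twoLevel Tmat j l))
  ∨ (∃ j : Fin n, M = oneLevel ω j)

/-- The matrix `T^m` for `m : ℤ`, i.e. `diag(1, ω^m)`. -/
def TmatZ (m : ℤ) : Matrix (Fin 2) (Fin 2) ℂ := !![1, 0; 0, ω ^ m]

/-- The matrix `W = diag(ω, ω⁻¹)`. -/
def Wmat : Matrix (Fin 2) (Fin 2) ℂ := !![ω, 0; 0, ω ^ (-1 : ℤ)]

/-- A two-level matrix of type `iX`, of type `T^{-m}(iH)T^m` for some `m ∈ ℤ`,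
or of type `W`. -/
def IsDet1Gen {n : ℕ} (M : Matrix (Fin n) (Fin n) ℂ) : Prop :=
  ∃ j l : Fin n, j ≠ l ∧
    (M = twoLevel (Complex.I • Xmat) j l
      ∨ (∃ m : ℤ, M = twoLevel (TmatZ (-m) * (Complex.I • Hmat) * TmatZ m) j l)
      ∨ M = twoLevel Wmat j l)


/-! ### Arithmetic in `ℤ[ω]` -/

lemma r2_sq : ((Real.sqrt 2 : ℝ) : ℂ) ^ 2 = 2 := by
  rw [← Complex.ofReal_pow, Real.sq_sqrt (by norm_num)]; norm_num

lemma r2_ne : ((Real.sqrt 2 : ℝ) : ℂ) ≠ 0 := by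
  intro h
  have := r2_sq
  rw [h] at this
  norm_num at this

lemma w_mul_r2 : ω * ((Real.sqrt 2 : ℝ) : ℂ) = 1 + Complex.I := by
  unfold ω
  exact div_mul_cancel₀ _ r2_ne

lemma w_sq : ω ^ 2 = Complex.I := by
  have h := w_mul_r2
  have h2 := r2_sq
  have h3 : (2 : ℂ) * ω ^ 2 = 2 * Complex.I := by
    calc (2 : ℂ) * ω ^ 2 = (ω * ((Real.sqrt 2 : ℝ) : ℂ)) ^ 2 := by rw [mul_pow, h2]; ring
      _ = 2 * Complex.I := by rw [h]; linear_combination Complex.I_sq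
  exact mul_left_cancel₀ two_ne_zero h3

lemma w4 : ω ^ 4 = -1 := by
  have : ω ^ 4 = (ω ^ 2) ^ 2 := by ring
  rw [this, w_sq, Complex.I_sq]

lemma w_ne : ω ≠ 0 := by
  intro h
  have := w4
  rw [h] at this
  norm_num at this

lemma r2_eq : ((Real.sqrt 2 : ℝ) : ℂ) = ω - ω ^ 3 := by
  apply mul_left_cancel₀ w_ne
  rw [w_mul_r2, ← w_sq]
  linear_combination w4

lemma star_w : star ω = -ω ^ 3 := by
  have h : star ω * ((Real.sqrt 2 : ℝ) : ℂ) = 1 - Complex.I := by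
    have := congrArg (starRingEnd ℂ) w_mul_r2
    rw [map_mul, Complex.conj_ofReal, map_add, map_one, Complex.conj_I] at this
    rw [sub_eq_add_neg]
    exact this
  apply mul_right_cancel₀ r2_ne
  rw [h, r2_eq, ← w_sq]
  linear_combination (1 - ω ^ 2) * w4

/-- The ring `ℤ[ω]`. -/
def Rs : Subring ℂ where
  carrier := {x | inZω x}
  mul_mem' := by
    rintro x y ⟨a, b, c, d, rfl⟩ ⟨a', b', c', d', rfl⟩
    refine ⟨a * d' + d * a' + b * c' + c * b', d * b' + b * d' + c * c' - a * a',
      d * c' + c * d' - (a * b' + b * a'), d * d' - (a * c' + c * a' + b * b'), ?_⟩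
    push_cast
    linear_combination ((a * c' + c * a' + b * b' : ℂ) + (a * b' + b * a') * ω + a * a' * ω ^ 2) * w4
  one_mem' := ⟨0, 0, 0, 1, by simp⟩
  add_mem' := by
    rintro x y ⟨a, b, c, d, rfl⟩ ⟨a', b', c', d', rfl⟩
    exact ⟨a + a', b + b', c + c', d + d', by push_cast; ring⟩
  zero_mem' := ⟨0, 0, 0, 0, by simp⟩
  neg_mem' := by
    rintro x ⟨a, b, c, d, rfl⟩
    exact ⟨-a, -b, -c, -d, by push_cast; ring⟩

lemma w_mem : ω ∈ Rs := ⟨0, 0, 1, 0, by simp⟩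

/-- The uniformizer `δ = 1 + ω` above 2. -/
def dl : ℂ := 1 + ω

lemma dl_mem : dl ∈ Rs := add_mem (one_mem _) w_mem

lemma two_eq : (2 : ℂ) = dl * (1 - ω + ω ^ 2 - ω ^ 3) := by
  unfold dl; linear_combination w4

lemma dl_ne : dl ≠ 0 := by
  intro h
  have := two_eq
  rw [h] at this
  norm_num at this

lemma dl_sq : dl ^ 2 = ((Real.sqrt 2 : ℝ) : ℂ) * (1 + ω + ω ^ 2) := by
  rw [r2_eq]; unfold dl; linear_combination (1 + ω) * w4

lemma r2_dl : ((Real.sqrt 2 : ℝ) : ℂ) = dl * (ω * (1 - ω)) := by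
  rw [r2_eq]; unfold dl; ring

/-- Divisibility by `δ`. -/
def Ev (x : ℂ) : Prop := ∃ y ∈ Rs, x = dl * y

/-- Congruent to one modulo `δ`. -/
def Od (x : ℂ) : Prop := ∃ y ∈ Rs, x = 1 + dl * y

lemma w_pow_sum_mem (y : ℂ) (h : ∃ a b c d : ℤ, y = a * ω ^ 3 + b * ω ^ 2 + c * ω + d) :
    y ∈ Rs := h

/-- Main coordinate lemma. -/
lemma coord (x : ℂ) (hx : x ∈ Rs) : ∃ A B : ℤ,
    star x * x = A + B * ((Real.sqrt 2 : ℝ) : ℂ) ∧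
    ((Even A ∧ Ev x) ∨ (Odd A ∧ Od x)) ∧ 0 ≤ A ∧ (A = 0 → x = 0) ∧
    (A = 1 → ∃ k : ℕ, x = ω ^ k) := by
  obtain ⟨a, b, c, d, rfl⟩ := hx
  refine ⟨a ^ 2 + b ^ 2 + c ^ 2 + d ^ 2, a * b + b * c + c * d - a * d, ?_, ?_, by positivity,
    ?_, ?_⟩
  · have h : star ((a : ℂ) * ω ^ 3 + b * ω ^ 2 + c * ω + d) =
        d - a * ω - b * ω ^ 2 - c * ω ^ 3 := by
      simp only [star_add, star_mul', star_pow, star_w, star_intCast]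
      linear_combination (- a * ω * (ω ^ 4 - 1) + b * ω ^ 2) * w4
    rw [h, r2_eq]
    push_cast
    linear_combination (-(a ^ 2 + b ^ 2 + c ^ 2 : ℂ) - (a * b + b * c) * ω - a * c * ω ^ 2) * w4
  · have key : (a : ℂ) * ω ^ 3 + b * ω ^ 2 + c * ω + d =
      dl * (a * ω ^ 2 + (b - a) * ω + (c - b + a)) + (d - c + b - a : ℤ) := by
      unfold dl; push_cast; ring
    have hpar : (a ^ 2 + b ^ 2 + c ^ 2 + d ^ 2) % 2 = (d - c + b - a) % 2 := by
      rcases Int.emod_two_eq_zero_or_one a with h1 | h1 <;>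
      rcases Int.emod_two_eq_zero_or_one b with h2 | h2 <;>
      rcases Int.emod_two_eq_zero_or_one c with h3 | h3 <;>
      rcases Int.emod_two_eq_zero_or_one d with h4 | h4 <;>
      simp [pow_two, Int.add_emod, Int.sub_emod, Int.mul_emod, h1, h2, h3, h4]
    rcases Int.even_or_odd' (d - c + b - a) with ⟨e, he | he⟩
    · left
      refine ⟨Int.even_iff.2 (by omega), _, w_pow_sum_mem _ ⟨-e, a + e, b - a - e, c - b + a + e, rfl⟩,
        ?_⟩
      rw [key, he]
      push_cast
      linear_combination (e : ℂ) * two_eq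
    · right
      refine ⟨Int.odd_iff.2 (by omega), _, w_pow_sum_mem _ ⟨-e, a + e, b - a - e, c - b + a + e, rfl⟩,
        ?_⟩
      rw [key, he]
      push_cast
      linear_combination (e : ℂ) * two_eq
  · intro h
    have ha : a = 0 := by nlinarith [sq_nonneg a, sq_nonneg b, sq_nonneg c, sq_nonneg d]
    have hb : b = 0 := by nlinarith [sq_nonneg a, sq_nonneg b, sq_nonneg c, sq_nonneg d]
    have hc : c = 0 := by nlinarith [sq_nonneg a, sq_nonneg b, sq_nonneg c, sq_nonneg d]
    have hd : d = 0 := by nlinarith [sq_nonneg a, sq_nonneg b, sq_nonneg c, sq_nonneg d]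
    simp [ha, hb, hc, hd]
  · intro h
    have bd : ∀ z : ℤ, z ^ 2 ≤ 1 → z = -1 ∨ z = 0 ∨ z = 1 := by
      intro z hz
      have : z ≤ 1 := by nlinarith
      have : -1 ≤ z := by nlinarith
      omega
    rcases bd a (by nlinarith [sq_nonneg b, sq_nonneg c, sq_nonneg d]) with h1 | h1 | h1 <;>
    rcases bd b (by nlinarith [sq_nonneg a, sq_nonneg c, sq_nonneg d]) with h2 | h2 | h2 <;>
    rcases bd c (by nlinarith [sq_nonneg a, sq_nonneg b, sq_nonneg d]) with h3 | h3 | h3 <;>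
    rcases bd d (by nlinarith [sq_nonneg a, sq_nonneg b, sq_nonneg c]) with h4 | h4 | h4 <;>
    rw [h1, h2, h3, h4] at h <;> norm_num at h <;> rw [h1, h2, h3, h4]
    · exact ⟨7, by push_cast; linear_combination (-ω ^ 3) * w4⟩
    · exact ⟨6, by push_cast; linear_combination (-ω ^ 2) * w4⟩
    · exact ⟨5, by push_cast; linear_combination (-ω) * w4⟩
    · exact ⟨4, by push_cast; linear_combination (-1) * w4⟩
    · exact ⟨0, by push_cast; ring⟩
    · exact ⟨1, by push_cast; ring⟩
    · exact ⟨2, by push_cast; ring⟩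
    · exact ⟨3, by push_cast; ring⟩

lemma irr (A B P Q : ℤ)
    (h : (A : ℂ) + B * ((Real.sqrt 2 : ℝ) : ℂ) = P + Q * ((Real.sqrt 2 : ℝ) : ℂ)) : A = P := by
  have h' : (A : ℝ) + B * Real.sqrt 2 = P + Q * Real.sqrt 2 := by exact_mod_cast h
  by_cases hBQ : B = Q
  · subst hBQ
    have : (A : ℝ) = P := by linarith
    exact_mod_cast this
  · exfalso
    apply irrational_sqrt_two
    refine ⟨((A - P : ℤ) : ℚ) / ((Q - B : ℤ) : ℚ), ?_⟩
    have : ((Q : ℝ) - B) ≠ 0 := by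
      rw [sub_ne_zero]; exact_mod_cast Ne.symm hBQ
    push_cast
    rw [div_eq_iff this]
    linarith

lemma norm_dl_pow (k : ℕ) : ∃ P Q : ℤ, star (dl ^ (k + 1)) * dl ^ (k + 1) =
    P + Q * ((Real.sqrt 2 : ℝ) : ℂ) ∧ Even P := by
  have h1 : star dl * dl = 2 + ((Real.sqrt 2 : ℝ) : ℂ) := by
    rw [r2_eq]; unfold dl; rw [star_add, star_one, star_w]; linear_combination -w4
  induction k with
  | zero => exact ⟨2, 1, by simpa using h1, even_two⟩
  | succ k ih =>
    obtain ⟨P, Q, h, hP⟩ := ih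
    refine ⟨2 * P + 2 * Q, P + 2 * Q, ?_, by simp [Int.even_add]⟩
    have : star (dl ^ (k + 1 + 1)) * dl ^ (k + 1 + 1) =
        (star (dl ^ (k + 1)) * dl ^ (k + 1)) * (star dl * dl) := by
      rw [pow_succ dl (k + 1), star_mul']; ring
    rw [this, h, h1]
    push_cast
    linear_combination (Q : ℂ) * r2_sq

lemma rep (y : ℂ) (hy : y ∈ Rs) : Ev y ∨ Od y := by
  obtain ⟨A, B, -, h, -⟩ := coord y hy
  rcases h with h | h
  · exact Or.inl h.2
  · exact Or.inr h.2

lemma two_dl3 : ∃ z ∈ Rs, (2 : ℂ) = dl ^ 3 * z := by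
  refine ⟨ω ^ 2 * (1 - ω) * (-ω + ω ^ 2 - ω ^ 3), ?_, ?_⟩
  · have := w_mem
    exact mul_mem (mul_mem (pow_mem this _) (sub_mem (one_mem _) this))
      (sub_mem (add_mem (neg_mem this) (pow_mem this _)) (pow_mem this _))
  · have h : 1 - ω = dl * (-ω + ω ^ 2 - ω ^ 3) := by unfold dl; linear_combination w4
    calc (2 : ℂ) = (dl * (ω * (1 - ω))) * (dl * (ω * (1 - ω))) := by
          rw [← r2_dl, ← pow_two, r2_sq]
      _ = dl ^ 2 * ω ^ 2 * (1 - ω) * (1 - ω) := by ring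
      _ = dl ^ 2 * ω ^ 2 * (1 - ω) * (dl * (-ω + ω ^ 2 - ω ^ 3)) := by rw [← h]
      _ = _ := by ring

/-- Every odd element is a power of `ω` modulo `δ³`. -/
lemma odd_pow (s : ℂ) (hs : Od s) : ∃ l : ℕ, ∃ z ∈ Rs, s = ω ^ l + dl ^ 3 * z := by
  obtain ⟨c, hc, h2⟩ := two_dl3
  have hd : dl ∈ Rs := dl_mem
  have hω : ω = dl - 1 := by unfold dl; ring
  obtain ⟨y, hy, rfl⟩ := hs
  rcases rep y hy with ⟨y', hy', rfl⟩ | ⟨y', hy', rfl⟩ <;>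
  rcases rep y' hy' with ⟨y'', hy'', rfl⟩ | ⟨y'', hy'', rfl⟩
  · exact ⟨0, y'', hy'', by ring⟩
  · exact ⟨2, dl * c + y'', add_mem (mul_mem hd hc) hy'', by
      rw [hω]; linear_combination dl * h2⟩
  · exact ⟨1, c + y'', add_mem hc hy'', by
      rw [hω]; linear_combination h2⟩
  · exact ⟨3, c - dl * c + 2 * dl ^ 2 * c - 1 + y'', add_mem (sub_mem (add_mem (sub_mem hc
      (mul_mem hd hc)) (mul_mem (mul_mem (ofNat_mem _ 2) (pow_mem hd _)) hc)) (one_mem _)) hy'', by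
      rw [hω]; linear_combination (1 - dl + 2 * dl ^ 2) * h2⟩

lemma w8 : ω ^ 8 = 1 := by linear_combination (ω ^ 4 - 1) * w4

lemma w8n (b : ℕ) : ω ^ (8 * b) = 1 := by rw [pow_mul, w8, one_pow]

lemma I_mem : Complex.I ∈ Rs := by rw [← w_sq]; exact pow_mem w_mem _

lemma w_zneg (m : ℕ) : ω ^ (-(m : ℤ)) = ω ^ (7 * m) := by
  rw [zpow_neg, zpow_natCast]
  apply inv_eq_of_mul_eq_one_left
  rw [← pow_add, ← w8n m]; congr 1; ring

lemma ev_mul {x y : ℂ} (hx : x ∈ Rs) (hy : Ev y) : Ev (x * y) := by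
  obtain ⟨z, hz, rfl⟩ := hy
  exact ⟨x * z, mul_mem hx hz, by ring⟩

lemma od_mem {x : ℂ} (hx : Od x) : x ∈ Rs := by
  obtain ⟨z, hz, rfl⟩ := hx
  exact add_mem (one_mem _) (mul_mem dl_mem hz)

lemma ev_mem {x : ℂ} (hx : Ev x) : x ∈ Rs := by
  obtain ⟨z, hz, rfl⟩ := hx
  exact mul_mem dl_mem hz

/-- Two odd elements become even under a suitable generator of Hadamard type. -/
lemma step (s t : ℂ) (hs : Od s) (ht : Od t) : ∃ m : ℕ,
    Ev (Complex.I * ((Real.sqrt 2 : ℝ) : ℂ)⁻¹ * s +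
      Complex.I * ((Real.sqrt 2 : ℝ) : ℂ)⁻¹ * ω ^ (m : ℤ) * t) ∧
    Ev (Complex.I * ((Real.sqrt 2 : ℝ) : ℂ)⁻¹ * ω ^ (-(m : ℤ)) * s +
      -(Complex.I * ((Real.sqrt 2 : ℝ) : ℂ)⁻¹) * t) := by
  have htR := od_mem ht
  obtain ⟨a, z, hz, h1⟩ := odd_pow s hs
  obtain ⟨b, z', hz', h2⟩ := odd_pow t ht
  refine ⟨a + 7 * b, ?_⟩
  rw [w_zneg, zpow_natCast]
  set m := a + 7 * b with hm
  have hmm : ω ^ (7 * m) * ω ^ m = 1 := by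
    rw [← pow_add, ← w8n m]; congr 1; ring
  have hab : ω ^ a = ω ^ m * ω ^ b := by
    rw [← pow_add, hm, show a + 7 * b + b = a + 8 * b by ring, pow_add, w8n, mul_one]
  have hE : s - ω ^ m * t = dl ^ 3 * (z - ω ^ m * z') := by
    rw [h1, h2, hab]; ring
  set Z := z - ω ^ m * z' with hZdef
  have hZ : Z ∈ Rs := sub_mem hz (mul_mem (pow_mem w_mem _) hz')
  have hw := w_mem
  have hu : (1 + ω + ω ^ 2) ∈ Rs := add_mem (add_mem (one_mem _) hw) (pow_mem hw _)
  set r : ℂ := ((Real.sqrt 2 : ℝ) : ℂ) with hr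
  have hrr : r⁻¹ * r = 1 := inv_mul_cancel₀ r2_ne
  have hF : r⁻¹ * (s - ω ^ m * t) = dl * ((1 + ω + ω ^ 2) * Z) := by
    rw [hE]
    have : dl ^ 3 = r * (1 + ω + ω ^ 2) * dl := by rw [← dl_sq]; ring
    rw [this]
    linear_combination (1 + ω + ω ^ 2) * dl * Z * hrr
  have hrd : r = dl * (ω * (1 - ω)) := r2_dl
  have h2r : r⁻¹ * 2 = r := by
    rw [← r2_sq, ← hr]; linear_combination r * hrr
  have hG : r⁻¹ * (s + ω ^ m * t) = dl * ((1 + ω + ω ^ 2) * Z + ω * (1 - ω) * ω ^ m * t) := by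
    linear_combination hF + ω ^ m * t * h2r + ω ^ m * t * hrd
  constructor
  · have : Complex.I * r⁻¹ * s + Complex.I * r⁻¹ * ω ^ m * t =
        Complex.I * (r⁻¹ * (s + ω ^ m * t)) := by ring
    rw [this, hG]
    exact ev_mul I_mem ⟨_, add_mem (mul_mem hu hZ) (mul_mem (mul_mem (mul_mem hw
      (sub_mem (one_mem _) hw)) (pow_mem hw _)) htR), rfl⟩
  · have : Complex.I * r⁻¹ * ω ^ (7 * m) * s + -(Complex.I * r⁻¹) * t =
        Complex.I * ω ^ (7 * m) * (r⁻¹ * (s - ω ^ m * t)) := by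
      linear_combination (Complex.I * r⁻¹) * t * hmm
    rw [this, hF]
    exact ev_mul (mul_mem I_mem (pow_mem hw _)) ⟨_, mul_mem hu hZ, rfl⟩

/-- The ring `𝔻[ω]`, as the localization of `ℤ[ω]` at `δ`. -/
def Ds : Subring ℂ where
  carrier := {x | ∃ k : ℕ, dl ^ k * x ∈ Rs}
  mul_mem' := by
    rintro x y ⟨k, hk⟩ ⟨l, hl⟩
    refine ⟨k + l, ?_⟩
    have := mul_mem hk hl
    rwa [show dl ^ k * x * (dl ^ l * y) = dl ^ (k + l) * (x * y) by ring] at this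
  one_mem' := ⟨0, by simpa using one_mem Rs⟩
  add_mem' := by
    rintro x y ⟨k, hk⟩ ⟨l, hl⟩
    refine ⟨k + l, ?_⟩
    have := add_mem (mul_mem (pow_mem dl_mem l) hk) (mul_mem (pow_mem dl_mem k) hl)
    rwa [show dl ^ l * (dl ^ k * x) + dl ^ k * (dl ^ l * y) = dl ^ (k + l) * (x + y) by ring]
      at this
  zero_mem' := ⟨0, by simpa using zero_mem Rs⟩
  neg_mem' := by
    rintro x ⟨k, hk⟩
    exact ⟨k, by simpa using neg_mem hk⟩

lemma Rs_le_Ds {x : ℂ} (h : x ∈ Rs) : x ∈ Ds := ⟨0, by simpa using h⟩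

lemma r2inv_mem : ((Real.sqrt 2 : ℝ) : ℂ)⁻¹ ∈ Ds := by
  refine ⟨2, ?_⟩
  rw [dl_sq, mul_comm, ← mul_assoc, inv_mul_cancel₀ r2_ne, one_mul]
  have hw := w_mem
  exact add_mem (add_mem (one_mem _) hw) (pow_mem hw _)

lemma dyadic_mem {q : ℚ} (h : IsDyadic q) : (q : ℂ) ∈ Ds := by
  obtain ⟨a, n, rfl⟩ := h
  have : (((a : ℚ) / 2 ^ n : ℚ) : ℂ) = a * (((Real.sqrt 2 : ℝ) : ℂ)⁻¹) ^ (2 * n) := by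
    push_cast
    rw [inv_pow, pow_mul, r2_sq]; rfl
  rw [this]
  exact mul_mem (intCast_mem _ a) (pow_mem r2inv_mem _)

lemma inD_mem {x : ℂ} (h : inDω x) : x ∈ Ds := by
  obtain ⟨a, b, c, d, ha, hb, hc, hd, rfl⟩ := h
  have hw := Rs_le_Ds w_mem
  exact add_mem (add_mem (add_mem (mul_mem (dyadic_mem ha) (pow_mem hw _))
    (mul_mem (dyadic_mem hb) (pow_mem hw _))) (mul_mem (dyadic_mem hc) hw)) (dyadic_mem hd)

lemma common_exp {n : ℕ} (u : Fin n → ℂ) (h : ∀ j, u j ∈ Ds) :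
    ∃ k : ℕ, ∀ j, dl ^ k * u j ∈ Rs := by
  have : ∀ j, ∀ᶠ k : ℕ in Filter.atTop, dl ^ k * u j ∈ Rs := by
    intro j
    obtain ⟨k, hk⟩ := h j
    filter_upwards [Filter.eventually_ge_atTop k] with l hl
    have : dl ^ l * u j = dl ^ (l - k) * (dl ^ k * u j) := by
      rw [← mul_assoc, ← pow_add, Nat.sub_add_cancel hl]
    rw [this]
    exact mul_mem (pow_mem dl_mem _) hk
  exact (Filter.eventually_all.2 this).exists

lemma not_ev_od {x : ℂ} (h : Ev x) (h' : Od x) : False := by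
  obtain ⟨y, hy, rfl⟩ := h
  obtain ⟨z, hz, h⟩ := h'
  have h1 : dl * (y - z) = 1 := by linear_combination h
  obtain ⟨A, B, hAB, -⟩ := coord (y - z) (sub_mem hy hz)
  obtain ⟨P, Q, hPQ, hP⟩ := norm_dl_pow 0
  rw [zero_add, pow_one] at hPQ
  have h2 : (star dl * dl) * (star (y - z) * (y - z)) = 1 := by
    calc _ = star (dl * (y - z)) * (dl * (y - z)) := by rw [star_mul']; ring
      _ = 1 := by rw [h1]; simp
  rw [hAB, hPQ] at h2
  have h3 : P * A + 2 * Q * B = 1 := by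
    apply irr _ (P * B + Q * A) 1 0
    push_cast
    linear_combination h2 - Q * B * r2_sq
  have : Even (P * A + 2 * Q * B) := (hP.mul_right A).add ⟨Q * B, by ring⟩
  rw [h3] at this
  exact absurd this (by decide)

/-! ### Two-level matrices -/

open Matrix in
lemma twoLevel_mulVec {n : ℕ} (U : Matrix (Fin 2) (Fin 2) ℂ) {j l : Fin n} (hjl : j ≠ l)
    (u : Fin n → ℂ) (p : Fin n) :
    (twoLevel U j l *ᵥ u) p = if p = j then U 0 0 * u j + U 0 1 * u l
      else if p = l then U 1 0 * u j + U 1 1 * u l else u p := by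
  have hlj := hjl.symm
  have key : ∀ q, twoLevel U j l p q * u q =
      (if p = j then (if q = j then U 0 0 * u q else 0) + (if q = l then U 0 1 * u q else 0)
      else if p = l then (if q = j then U 1 0 * u q else 0) + (if q = l then U 1 1 * u q else 0)
      else if q = p then u q else 0) := by
    intro q
    simp only [twoLevel, Matrix.of_apply]
    by_cases h1 : p = j <;> by_cases h2 : p = l <;> by_cases h3 : q = j <;> by_cases h4 : q = l <;>
      simp_all [eq_comm]
  simp only [mulVec, dotProduct, key]
  split_ifs <;> simp [Finset.sum_add_distrib]

/-- The embedding of the `j, l` coordinates. -/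
def emb {n : ℕ} (j l : Fin n) : Matrix (Fin n) (Fin 2) ℂ :=
  Matrix.of fun p c => if p = (if c = 0 then j else l) then 1 else 0

lemma emb_mul {n : ℕ} {j l : Fin n} (hjl : j ≠ l) : (emb j l).transpose * emb j l = 1 := by
  ext a b
  fin_cases a <;> fin_cases b <;> simp [emb, Matrix.mul_apply, hjl, hjl.symm]

lemma twoLevel_eq {n : ℕ} (U : Matrix (Fin 2) (Fin 2) ℂ) {j l : Fin n} (hjl : j ≠ l) :
    twoLevel U j l = 1 + emb j l * ((U - 1) * (emb j l).transpose) := by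
  have hlj := hjl.symm
  ext p q
  simp only [twoLevel, Matrix.of_apply, Matrix.add_apply, Matrix.mul_apply, emb, Fin.sum_univ_two,
    Matrix.sub_apply, Matrix.one_apply, Matrix.transpose_apply]
  by_cases h1 : p = j <;> by_cases h2 : p = l <;> by_cases h3 : q = j <;> by_cases h4 : q = l <;>
      simp_all [eq_comm]

lemma twoLevel_det {n : ℕ} (U : Matrix (Fin 2) (Fin 2) ℂ) {j l : Fin n} (hjl : j ≠ l) :
    (twoLevel U j l).det = U.det := by
  rw [twoLevel_eq U hjl, Matrix.det_one_add_mul_comm, Matrix.mul_assoc, emb_mul hjl]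
  simp

lemma twoLevel_mul {n : ℕ} (U V : Matrix (Fin 2) (Fin 2) ℂ) {j l : Fin n} (hjl : j ≠ l) :
    twoLevel U j l * twoLevel V j l = twoLevel (U * V) j l := by
  have h := emb_mul hjl
  simp only [twoLevel_eq _ hjl]
  set E := emb j l
  have : E * ((U - 1) * E.transpose) * (E * ((V - 1) * E.transpose)) =
      E * ((U - 1) * (V - 1) * E.transpose) := by
    calc _ = E * ((U - 1) * ((E.transpose * E) * ((V - 1) * E.transpose))) := by
          simp only [Matrix.mul_assoc]
      _ = _ := by rw [h, Matrix.one_mul, Matrix.mul_assoc (U - 1)]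
  rw [add_mul, mul_add, mul_add, this, one_mul, mul_one, one_mul, add_assoc, ← Matrix.mul_add,
    ← Matrix.mul_add, ← Matrix.add_mul, ← Matrix.add_mul]
  congr 4
  noncomm_ring

lemma twoLevel_one {n : ℕ} {j l : Fin n} (hjl : j ≠ l) : twoLevel 1 j l = 1 := by
  rw [twoLevel_eq _ hjl]; simp

lemma twoLevel_star {n : ℕ} (U : Matrix (Fin 2) (Fin 2) ℂ) {j l : Fin n} (hjl : j ≠ l) :
    star (twoLevel U j l) = twoLevel (star U) j l := by
  have hlj := hjl.symm
  ext p q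
  simp only [Matrix.star_apply, twoLevel, Matrix.of_apply]
  by_cases h1 : p = j <;> by_cases h2 : p = l <;> by_cases h3 : q = j <;> by_cases h4 : q = l <;>
      simp_all [eq_comm]

/-- The three types of 2 × 2 generators. -/
def Ty (V : Matrix (Fin 2) (Fin 2) ℂ) : Prop :=
  V = Complex.I • Xmat ∨ (∃ m : ℤ, V = TmatZ (-m) * (Complex.I • Hmat) * TmatZ m) ∨ V = Wmat

lemma K_eq (m : ℤ) : TmatZ (-m) * (Complex.I • Hmat) * TmatZ m =
    !![Complex.I * ((Real.sqrt 2 : ℝ) : ℂ)⁻¹, Complex.I * ((Real.sqrt 2 : ℝ) : ℂ)⁻¹ * ω ^ m;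
      Complex.I * ((Real.sqrt 2 : ℝ) : ℂ)⁻¹ * ω ^ (-m), -(Complex.I * ((Real.sqrt 2 : ℝ) : ℂ)⁻¹)] := by
  have h : ω ^ (-m) * ω ^ m = 1 := by rw [← zpow_add₀ w_ne]; simp
  ext a b
  fin_cases a <;> fin_cases b <;> simp [TmatZ, Hmat, Matrix.mul_apply, Fin.sum_univ_two]
  · field_simp [r2_ne, w_ne]
  · field_simp [r2_ne, w_ne]

lemma X_eq : Complex.I • Xmat = !![0, Complex.I; Complex.I, 0] := by
  ext a b
  fin_cases a <;> fin_cases b <;> simp [Xmat]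

lemma W_eq : Wmat = !![ω, 0; 0, ω ^ 7] := by
  have h := w_zneg 1
  norm_num at h
  ext a b
  fin_cases a <;> fin_cases b <;> simp [Wmat, h]

lemma w_zpow_mem (m : ℤ) : ω ^ m ∈ Rs := by
  obtain ⟨k, rfl | rfl⟩ := m.eq_nat_or_neg
  · rw [zpow_natCast]; exact pow_mem w_mem _
  · rw [w_zneg]; exact pow_mem w_mem _

lemma star_zw (m : ℤ) : star (ω ^ m) = ω ^ (-m) := by
  have h : star ω = ω⁻¹ := by
    rw [star_w]
    apply eq_inv_of_mul_eq_one_left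
    linear_combination -w4
  rw [star_zpow₀, h, inv_zpow, zpow_neg]

lemma Ty_props (V : Matrix (Fin 2) (Fin 2) ℂ) (h : Ty V) :
    star V * V = 1 ∧ V.det = 1 ∧ V ^ 8 = 1 ∧ ∀ a b, V a b ∈ Ds := by
  have hI := Rs_le_Ds I_mem
  have hw := Rs_le_Ds w_mem
  rcases h with rfl | ⟨m, rfl⟩ | rfl
  · rw [X_eq]
    have h2 : (!![0, Complex.I; Complex.I, 0] : Matrix (Fin 2) (Fin 2) ℂ) ^ 2 = -1 := by
      ext a b
      fin_cases a <;> fin_cases b <;> simp [pow_two, Matrix.mul_apply]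
    refine ⟨?_, ?_, ?_, ?_⟩
    · ext a b
      fin_cases a <;> fin_cases b <;> simp [Matrix.mul_apply]
    · simp [Matrix.det_fin_two]
    · rw [show 8 = 2 * 4 by norm_num, pow_mul, h2]
      exact Even.neg_one_pow (by decide)
    · intro a b
      fin_cases a <;> fin_cases b <;> simp [hI, zero_mem]
  · rw [K_eq]
    have hr := r2_sq
    have hrr : ((Real.sqrt 2 : ℝ) : ℂ)⁻¹ ^ 2 * 2 = 1 := by
      rw [inv_pow, hr]; norm_num
    have hsr : star (((Real.sqrt 2 : ℝ) : ℂ)⁻¹) = ((Real.sqrt 2 : ℝ) : ℂ)⁻¹ := by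
      rw [← Complex.ofReal_inv]; exact Complex.conj_ofReal _
    have hsI : star Complex.I = -Complex.I := Complex.conj_I
    have hz : ω ^ (-m) * ω ^ m = 1 := by rw [← zpow_add₀ w_ne]; simp
    have hs1 := star_zw m
    have hs2 := star_zw (-m)
    rw [neg_neg] at hs2
    have hm1 := Rs_le_Ds (w_zpow_mem m)
    have hm2 := Rs_le_Ds (w_zpow_mem (-m))
    have hrm := r2inv_mem
    have hII := Complex.I_sq
    generalize ((Real.sqrt 2 : ℝ) : ℂ)⁻¹ = r at *
    generalize ω ^ m = x at *
    generalize ω ^ (-m) = y at *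
    generalize Complex.I = i at *
    have h2 : (!![i * r, i * r * x; i * r * y, -(i * r)] : Matrix (Fin 2) (Fin 2) ℂ) ^ 2 = -1 := by
      rw [pow_two]
      ext a b
      fin_cases a <;> fin_cases b <;> simp [Matrix.mul_apply]
      · linear_combination i ^ 2 * r ^ 2 * hz + i ^ 2 * hrr + hII
      · ring
      · ring
      · linear_combination i ^ 2 * r ^ 2 * hz + i ^ 2 * hrr + hII
    refine ⟨?_, ?_, ?_, ?_⟩
    · ext a b
      simp only [Matrix.mul_apply, Matrix.star_apply, Fin.sum_univ_two]
      fin_cases a <;> fin_cases b <;>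
        simp only [Fin.zero_eta, Fin.mk_one, Matrix.of_apply, Matrix.cons_val_zero,
          Matrix.cons_val_one, Matrix.cons_val', Matrix.cons_val_fin_one, star_mul', star_neg, hsr,
          hsI, hs1, hs2, Matrix.one_apply_eq, Matrix.one_apply_ne, ne_eq, zero_ne_one, one_ne_zero,
          not_false_eq_true]
      · linear_combination - i ^ 2 * r ^ 2 * hz - i ^ 2 * hrr - hII
      · ring
      · ring
      · linear_combination - i ^ 2 * r ^ 2 * hz - i ^ 2 * hrr - hII
    · simp only [Matrix.det_fin_two, Matrix.of_apply, Matrix.cons_val_zero,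
          Matrix.cons_val_one, Matrix.cons_val', Matrix.cons_val_fin_one]
      linear_combination - i ^ 2 * r ^ 2 * hz - i ^ 2 * hrr - hII
    · rw [show 8 = 2 * 4 by norm_num, pow_mul, h2]
      exact Even.neg_one_pow (by decide)
    · have hir := mul_mem hI hrm
      intro a b
      fin_cases a <;> fin_cases b
      · exact hir
      · exact mul_mem hir hm1
      · exact mul_mem hir hm2
      · exact neg_mem hir
  · rw [W_eq]
    have hd : (!![ω, 0; 0, ω ^ 7] : Matrix (Fin 2) (Fin 2) ℂ) = Matrix.diagonal ![ω, ω ^ 7] := by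
      ext a b
      fin_cases a <;> fin_cases b <;> simp
    refine ⟨?_, ?_, ?_, ?_⟩
    · ext a b
      have := star_w
      simp only [Matrix.mul_apply, Matrix.star_apply, Fin.sum_univ_two]
      fin_cases a <;> fin_cases b <;>
        simp only [Fin.zero_eta, Fin.mk_one, Matrix.of_apply, Matrix.cons_val_zero,
          Matrix.cons_val_one, Matrix.cons_val', Matrix.cons_val_fin_one, star_pow, star_zero, star_w,
          Matrix.one_apply_eq, Matrix.one_apply_ne, ne_eq, zero_ne_one, one_ne_zero,
          not_false_eq_true]
      · linear_combination -w4
      · ring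
      · ring
      · have h28 := w8n 3
        have : (-ω ^ 3) ^ 7 * ω ^ 7 = - (ω ^ (8 * 3) * ω ^ 4) := by ring
        rw [zero_mul, zero_add, this, h28, w4]; norm_num
    · simp only [Matrix.det_fin_two, Matrix.of_apply, Matrix.cons_val_zero,
          Matrix.cons_val_one, Matrix.cons_val', Matrix.cons_val_fin_one]
      linear_combination w8
    · rw [hd, Matrix.diagonal_pow, ← Matrix.diagonal_one]
      congr 1
      ext a
      fin_cases a
      · simpa using w8
      · simp [← pow_mul]
        exact w8n 7
    · intro a b
      fin_cases a <;> fin_cases b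
      · exact hw
      · exact zero_mem Ds
      · exact zero_mem Ds
      · exact pow_mem hw _

/-! ### Reduction of columns -/

open Matrix

/-- Generators acting on indices in `s`. -/
def Gens {n : ℕ} (s : Set (Fin n)) : Set (Matrix (Fin n) (Fin n) ℂ) :=
  {M | ∃ j ∈ s, ∃ l ∈ s, j ≠ l ∧ ∃ V, Ty V ∧ M = twoLevel V j l}

lemma gens_det1 {n : ℕ} (s : Set (Fin n)) {M : Matrix (Fin n) (Fin n) ℂ} (h : M ∈ Gens s) :
    IsDet1Gen M := by
  obtain ⟨j, -, l, -, hjl, V, hV, rfl⟩ := h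
  refine ⟨j, l, hjl, ?_⟩
  rcases hV with rfl | ⟨m, rfl⟩ | rfl
  · exact Or.inl rfl
  · exact Or.inr (Or.inl ⟨m, rfl⟩)
  · exact Or.inr (Or.inr rfl)

/-- The properties shared by all products of generators. -/
def Nice {n : ℕ} (s : Set (Fin n)) (g : Matrix (Fin n) (Fin n) ℂ) : Prop :=
  star g * g = 1 ∧ g.det = 1 ∧ (∀ a b, g a b ∈ Ds) ∧
    ((∀ u : Fin n → ℂ, ∀ j, j ∉ s → (g *ᵥ u) j = u j) ∧
      ∀ u : Fin n → ℂ, (∀ j ∈ s, u j = 0) → g *ᵥ u = u) ∧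
    ∃ h ∈ Submonoid.closure (Gens s), h * g = 1

lemma twoLevel_pow {n : ℕ} (U : Matrix (Fin 2) (Fin 2) ℂ) {j l : Fin n} (hjl : j ≠ l) (k : ℕ) :
    twoLevel U j l ^ k = twoLevel (U ^ k) j l := by
  induction k with
  | zero => simp [twoLevel_one hjl]
  | succ k ih => rw [pow_succ, ih, twoLevel_mul _ _ hjl, pow_succ]

lemma nice_gen {n : ℕ} (s : Set (Fin n)) (M : Matrix (Fin n) (Fin n) ℂ) (h : M ∈ Gens s) :
    Nice s M := by
  have hM := h
  obtain ⟨j, hj, l, hl, hjl, V, hV, rfl⟩ := h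
  obtain ⟨h1, h2, h3, h4⟩ := Ty_props V hV
  refine ⟨?_, ?_, ?_, ⟨?_, ?_⟩, ?_⟩
  · rw [twoLevel_star _ hjl, twoLevel_mul _ _ hjl, h1, twoLevel_one hjl]
  · rw [twoLevel_det _ hjl, h2]
  · intro a b
    simp only [twoLevel, Matrix.of_apply]
    split_ifs <;> first | exact h4 _ _ | exact one_mem Ds | exact zero_mem Ds
  · intro u p hp
    rw [twoLevel_mulVec _ hjl, if_neg (by rintro rfl; exact hp hj),
      if_neg (by rintro rfl; exact hp hl)]
  · intro u hu
    ext p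
    rw [twoLevel_mulVec _ hjl, hu j hj, hu l hl]
    by_cases hpj : p = j
    · subst hpj; simp [hu p hj]
    · by_cases hpl : p = l
      · subst hpl; simp [hu p hl]
      · simp [hpj, hpl]
  · refine ⟨twoLevel V j l ^ 7, pow_mem (Submonoid.subset_closure hM) _, ?_⟩
    rw [← pow_succ, twoLevel_pow _ hjl, h3, twoLevel_one hjl]

lemma nice_clo {n : ℕ} (s : Set (Fin n)) (g : Matrix (Fin n) (Fin n) ℂ)
    (h : g ∈ Submonoid.closure (Gens s)) : Nice s g := by
  induction h using Submonoid.closure_induction with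
  | mem x hx => exact nice_gen s x hx
  | one =>
    refine ⟨by simp, by simp, ?_, ⟨by simp, by simp⟩, 1, one_mem _, by simp⟩
    intro a b
    rw [Matrix.one_apply]
    split_ifs
    · exact one_mem Ds
    · exact zero_mem Ds
  | mul x y hx hy ihx ihy =>
    obtain ⟨a1, a2, a3, ⟨a4, a6⟩, x', hx', a5⟩ := ihx
    obtain ⟨b1, b2, b3, ⟨b4, b6⟩, y', hy', b5⟩ := ihy
    refine ⟨?_, ?_, ?_, ⟨?_, ?_⟩, y' * x', mul_mem hy' hx', ?_⟩
    · rw [star_mul, mul_assoc, ← mul_assoc (star x), a1, one_mul, b1]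
    · rw [det_mul, a2, b2, one_mul]
    · intro a b
      rw [Matrix.mul_apply]
      exact sum_mem fun c _ => mul_mem (a3 _ _) (b3 _ _)
    · intro u j hj
      rw [← mulVec_mulVec, a4 _ _ hj, b4 _ _ hj]
    · intro u hu
      rw [← mulVec_mulVec, b6 u hu, a6 u hu]
    · rw [mul_assoc, ← mul_assoc x', a5, one_mul, b5]

/-- `u` can be moved to the basis vector `e_p`. -/
def Reach {n : ℕ} (s : Set (Fin n)) (p : Fin n) (u : Fin n → ℂ) : Prop :=
  ∃ g ∈ Submonoid.closure (Gens s), g *ᵥ u = Pi.single p 1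

lemma reach_of_gen {n : ℕ} {s : Set (Fin n)} {p : Fin n} {u : Fin n → ℂ}
    {M : Matrix (Fin n) (Fin n) ℂ} (hM : M ∈ Gens s) (h : Reach s p (M *ᵥ u)) : Reach s p u := by
  obtain ⟨g, hg, h⟩ := h
  exact ⟨g * M, mul_mem hg (Submonoid.subset_closure hM), by rw [← mulVec_mulVec, h]⟩

lemma reach_phase {n : ℕ} {s : Set (Fin n)} {p q : Fin n} (hp : p ∈ s) (hq : q ∈ s) (hpq : p ≠ q)
    (a : ℕ) : Reach s p (Pi.single p (ω ^ a)) := by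
  have key : ∀ a b : ℕ, Reach s p (Pi.single p (ω ^ (a + b))) →
      Reach s p (Pi.single p (ω ^ a)) := by
    intro a b
    induction b with
    | zero => exact id
    | succ b ih =>
      intro h
      apply ih
      have hM : twoLevel Wmat p q ∈ Gens s := ⟨p, hp, q, hq, hpq, _, Or.inr (Or.inr rfl), rfl⟩
      apply reach_of_gen hM
      convert h using 1
      ext c
      rw [twoLevel_mulVec _ hpq]
      by_cases h1 : c = p
      · subst h1
        simp [Wmat, hpq.symm]
        ring
      · by_cases h2 : c = q
        · subst h2
          simp [Wmat, h1]
        · simp [h1, h2]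
  apply key a (7 * a)
  rw [show a + 7 * a = 8 * a by ring, w8n]
  exact ⟨1, one_mem _, by rw [one_mulVec]⟩

lemma reach_zero {n : ℕ} {s : Set (Fin n)} {p q : Fin n} (hp : p ∈ s) (hq : q ∈ s) (hpq : p ≠ q)
    (u : Fin n → ℂ) (hs : ∀ j, j ∉ s → u j = 0) (hn : star u ⬝ᵥ u = 1) (hR : ∀ j, u j ∈ Rs) :
    Reach s p u := by
  choose A B h1 _ h3 h4 h5 using fun j => coord (u j) (hR j)
  have hsum : ∑ j, A j = 1 := by
    apply irr _ (∑ j, B j) 1 0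
    have : star u ⬝ᵥ u = ∑ j, (A j + B j * ((Real.sqrt 2 : ℝ) : ℂ)) := by
      simp only [dotProduct, Pi.star_apply, h1]
    rw [hn, Finset.sum_add_distrib, ← Finset.sum_mul] at this
    push_cast
    rw [← this]; simp
  have hex : ∃ j, A j ≠ 0 := by
    by_contra! h
    simp [h] at hsum
  obtain ⟨j, hj⟩ := hex
  have hsplit : A j + ∑ i ∈ Finset.univ.erase j, A i = 1 := by
    rw [Finset.add_sum_erase _ _ (Finset.mem_univ j), hsum]
  have hnn : 0 ≤ ∑ i ∈ Finset.univ.erase j, A i := Finset.sum_nonneg fun i _ => h3 i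
  have hA1 : A j = 1 := by have := h3 j; omega
  have hz : ∀ i, i ≠ j → u i = 0 := by
    intro i hi
    apply h4
    have h0 : ∑ i ∈ Finset.univ.erase j, A i = 0 := by omega
    exact (Finset.sum_eq_zero_iff_of_nonneg fun i _ => h3 i).1 h0 i (by simp [hi])
  obtain ⟨a, ha⟩ := h5 j hA1
  have hu : u = Pi.single j (ω ^ a) := by
    ext i
    by_cases hi : i = j
    · subst hi; simp [ha]
    · simp [hi, hz i hi]
  by_cases hjp : j = p
  · subst hjp; rw [hu]; exact reach_phase hp hq hpq a
  · have hjs : j ∈ s := by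
      by_contra h
      have := hs j h
      rw [ha] at this
      exact pow_ne_zero _ w_ne this
    have hpj : p ≠ j := fun h => hjp h.symm
    have hM : twoLevel (Complex.I • Xmat) p j ∈ Gens s := ⟨p, hp, j, hjs, hpj, _, Or.inl rfl, rfl⟩
    apply reach_of_gen hM
    convert reach_phase hp hq hpq (a + 2) using 1
    ext c
    rw [twoLevel_mulVec _ hpj, hu, pow_add, w_sq]
    by_cases h1 : c = p
    · subst h1
      simp [Xmat, hpj]
      ring
    · by_cases h2 : c = j
      · subst h2
        simp [Xmat, h1, hpj]
      · simp [h1, h2]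

lemma norm_gen {n : ℕ} (g : Matrix (Fin n) (Fin n) ℂ) (h : star g * g = 1) (u : Fin n → ℂ) :
    star (g *ᵥ u) ⬝ᵥ (g *ᵥ u) = star u ⬝ᵥ u := by
  rw [star_mulVec, dotProduct_mulVec, vecMul_vecMul, ← star_eq_conjTranspose, h, vecMul_one]

open Classical in
lemma reach_all {n : ℕ} {s : Set (Fin n)} {p q : Fin n} (hp : p ∈ s) (hq : q ∈ s) (hpq : p ≠ q)
    (k : ℕ) : ∀ (c : ℕ) (u : Fin n → ℂ), (∀ j, j ∉ s → u j = 0) → star u ⬝ᵥ u = 1 →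
    (∀ j, dl ^ k * u j ∈ Rs) →
    (Finset.univ.filter fun j => ¬ Ev (dl ^ k * u j)).card = c → Reach s p u := by
  induction k with
  | zero =>
    intro c u hs hn hR _
    exact reach_zero hp hq hpq u hs hn (by simpa using hR)
  | succ k ihk =>
    intro c
    induction c using Nat.strong_induction_on with
    | _ c ihc =>
    intro u hs hn hR hc
    by_cases hall : ∀ j, Ev (dl ^ (k + 1) * u j)
    · refine ihk _ u hs hn (fun j => ?_) rfl
      obtain ⟨y, hy, h⟩ := hall j
      have : dl ^ k * u j = y := by
        apply mul_left_cancel₀ dl_ne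
        rw [← h]; ring
      rw [this]; exact hy
    -- parity of the number of odd entries
    choose A B h1 h2 _ _ _ using fun j => coord _ (hR j)
    obtain ⟨P, Q, hPQ, hP⟩ := norm_dl_pow k
    have hsum : ∑ j, A j = P := by
      apply irr _ (∑ j, B j) P Q
      have : ∑ j, star (dl ^ (k + 1) * u j) * (dl ^ (k + 1) * u j) =
          star (dl ^ (k + 1)) * dl ^ (k + 1) * (star u ⬝ᵥ u) := by
        simp only [dotProduct, Pi.star_apply, Finset.mul_sum, star_mul']
        exact Finset.sum_congr rfl fun j _ => by ring
      rw [hn, mul_one, hPQ] at this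
      simp only [h1, Finset.sum_add_distrib, ← Finset.sum_mul] at this
      push_cast
      exact this
    push Not at hall
    obtain ⟨j, hj⟩ := hall
    have hex : ∃ l, l ≠ j ∧ ¬ Ev (dl ^ (k + 1) * u l) := by
      by_contra! hcon
      have hAj : Odd (A j) := by
        rcases h2 j with h | h
        · exact absurd h.2 hj
        · exact h.1
      have hoth : Even (∑ i ∈ Finset.univ.erase j, A i) := by
        apply Finset.even_sum
        intro i hi
        have hEv := hcon i (by simpa using hi)
        rcases h2 i with h | h
        · exact h.1
        · exact (not_ev_od hEv h.2).elim
      have hsplit : A j + ∑ i ∈ Finset.univ.erase j, A i = P := by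
        rw [Finset.add_sum_erase _ _ (Finset.mem_univ j), hsum]
      rw [← hsplit] at hP
      exact (Int.not_even_iff_odd.2 (hAj.add_even hoth)) hP
    obtain ⟨l, hlj, hl⟩ := hex
    have hjl : j ≠ l := hlj.symm
    have odd_of : ∀ i, ¬ Ev (dl ^ (k + 1) * u i) → Od (dl ^ (k + 1) * u i) := fun i hi =>
      (rep _ (hR i)).resolve_left hi
    have mem_of : ∀ i, ¬ Ev (dl ^ (k + 1) * u i) → i ∈ s := by
      intro i hi
      by_contra h
      exact hi ⟨0, zero_mem _, by rw [hs i h]; simp⟩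
    obtain ⟨m, hm1, hm2⟩ := step _ _ (odd_of j hj) (odd_of l hl)
    have hM : twoLevel (TmatZ (-(m : ℤ)) * (Complex.I • Hmat) * TmatZ m) j l ∈ Gens s :=
      ⟨j, mem_of j hj, l, mem_of l hl, hjl, _, Or.inr (Or.inl ⟨m, rfl⟩), rfl⟩
    have hnice := nice_gen s _ hM
    apply reach_of_gen hM
    have hact := twoLevel_mulVec (TmatZ (-(m : ℤ)) * (Complex.I • Hmat) * TmatZ m) hjl u
    set u' := twoLevel (TmatZ (-(m : ℤ)) * (Complex.I • Hmat) * TmatZ m) j l *ᵥ u with hu'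
    rw [K_eq] at hact
    have hej : Ev (dl ^ (k + 1) * u' j) := by
      convert hm1 using 1
      rw [hact]
      simp
      ring
    have hel : Ev (dl ^ (k + 1) * u' l) := by
      convert hm2 using 1
      rw [hact]
      simp [hlj]
      ring
    have heo : ∀ i, i ≠ j → i ≠ l → u' i = u i := by
      intro i hi hi'
      rw [hact, if_neg hi, if_neg hi']
    have hR' : ∀ i, dl ^ (k + 1) * u' i ∈ Rs := by
      intro i
      by_cases h1 : i = j
      · subst h1; exact ev_mem hej
      by_cases h2 : i = l
      · subst h2; exact ev_mem hel
      rw [heo i h1 h2]; exact hR i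
    refine ihc _ ?_ u' ?_ ?_ hR' rfl
    · rw [← hc]
      apply Finset.card_lt_card
      rw [Finset.ssubset_iff_of_subset]
      · exact ⟨j, by simpa using hj, by simpa using hej⟩
      · intro i hi
        rw [Finset.mem_filter] at hi ⊢
        refine ⟨hi.1, ?_⟩
        by_cases h1 : i = j
        · subst h1; exact absurd hej hi.2
        by_cases h2 : i = l
        · subst h2; exact absurd hel hi.2
        rw [← heo i h1 h2]; exact hi.2
    · intro i hi
      rw [hu', hnice.2.2.2.1.1 u i hi, hs i hi]
    · rw [hu', norm_gen _ hnice.1, hn]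

/-! ### The main induction -/

lemma row_zero {n : ℕ} {U : Matrix (Fin n) (Fin n) ℂ} (hU : star U * U = 1) {j : Fin n}
    (hj : ∀ i, U i j = if i = j then 1 else 0) {k : Fin n} (hk : k ≠ j) : U j k = 0 := by
  have h := congrFun (congrFun hU j) k
  rw [Matrix.mul_apply, Matrix.one_apply_ne hk.symm] at h
  simpa [Matrix.star_apply, hj, apply_ite star] using h

lemma main_ind {n : ℕ} (d : ℕ) : ∀ (U : Matrix (Fin n) (Fin n) ℂ), star U * U = 1 →
    (∀ i j, U i j ∈ Ds) → U.det = 1 →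
    (∀ j : Fin n, (j : ℕ) + 1 + d < n → ∀ i, U i j = if i = j then 1 else 0) →
    U ∈ Submonoid.closure (Gens (Set.univ : Set (Fin n))) := by
  induction d with
  | zero =>
    intro U hU hD hdet hcol
    have hU1 : U = 1 := by
      rcases n with _ | N
      · exact Subsingleton.elim _ _
      have hc : ∀ j : Fin (N + 1), j ≠ Fin.last N → ∀ i, U i j = if i = j then 1 else 0 := by
        intro j hj
        apply hcol
        have := Fin.val_lt_last hj
        omega
      have hdiag : U = Matrix.diagonal fun i => U i i := by
        ext i j
        by_cases hij : i = j
        · subst hij; simp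
        · rw [Matrix.diagonal_apply_ne _ hij]
          by_cases hj : j = Fin.last N
          · have hi : i ≠ Fin.last N := by rintro rfl; exact hij hj.symm
            exact row_zero hU (hc i hi) (Ne.symm hij)
          · rw [hc j hj i, if_neg hij]
      have hlast : U (Fin.last N) (Fin.last N) = 1 := by
        rw [hdiag, Matrix.det_diagonal, Finset.prod_eq_single (Fin.last N)] at hdet
        · exact hdet
        · intro b _ hb
          rw [hc b hb b, if_pos rfl]
        · simp
      rw [hdiag, ← Matrix.diagonal_one]
      congr 1
      ext i
      by_cases hi : i = Fin.last N
      · rw [hi, hlast]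
      · rw [hc i hi i, if_pos rfl]
    rw [hU1]
    exact one_mem _
  | succ d ih =>
    intro U hU hD hdet hcol
    by_cases hnd : n < d + 2
    · exact ih U hU hD hdet fun j hj => by omega
    push Not at hnd
    let p : Fin n := ⟨n - 2 - d, by omega⟩
    let q : Fin n := ⟨n - 1 - d, by omega⟩
    have hpv : (p : ℕ) = n - 2 - d := rfl
    have hqv : (q : ℕ) = n - 1 - d := rfl
    let s : Set (Fin n) := {i | p ≤ i}
    have hp : p ∈ s := le_refl p
    have hq : q ∈ s := by
      change p ≤ q
      rw [Fin.le_def]; omega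
    have hpq : p ≠ q := by
      intro h
      have := congrArg Fin.val h
      omega
    have hns : ∀ i, i ∉ s → (i : ℕ) + 1 + (d + 1) < n := by
      intro i hi
      have : ¬ p ≤ i := hi
      rw [Fin.le_def] at this
      omega
    obtain ⟨k, hk⟩ := common_exp (fun i => U i p) (fun i => hD i p)
    have hreach : Reach s p (fun i => U i p) := by
      refine reach_all hp hq hpq k _ _ ?_ ?_ hk rfl
      · intro i hi
        refine row_zero hU (hcol i (hns i hi)) ?_
        rintro rfl
        exact hi hp
      · have h := congrFun (congrFun hU p) p
        rw [Matrix.mul_apply, Matrix.one_apply_eq] at h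
        exact h
    obtain ⟨g, hg, hgp⟩ := hreach
    obtain ⟨g1, g2, g3, g4, h, hh, hhg⟩ := nice_clo s g hg
    have hsub : Submonoid.closure (Gens s) ≤ Submonoid.closure (Gens (Set.univ : Set (Fin n))) := by
      apply Submonoid.closure_mono
      rintro M ⟨j, -, l, -, hM⟩
      exact ⟨j, trivial, l, trivial, hM⟩
    have hcolg : ∀ i j, (g * U) i j = (g *ᵥ fun a => U a j) i := fun i j => rfl
    have hgU : g * U ∈ Submonoid.closure (Gens (Set.univ : Set (Fin n))) := by
      apply ih
      · rw [star_mul, mul_assoc, ← mul_assoc (star g), g1, one_mul, hU]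
      · intro i j
        rw [Matrix.mul_apply]
        exact sum_mem fun c _ => mul_mem (g3 _ _) (hD _ _)
      · rw [det_mul, g2, hdet, one_mul]
      · intro j hj i
        rw [hcolg]
        by_cases hjp : j = p
        · subst hjp
          rw [hgp, Pi.single_apply]
        · have hjs : j ∉ s := by
            intro hjs
            have h1 : p ≤ j := hjs
            rw [Fin.le_def] at h1
            exact hjp (Fin.ext (by omega))
          have hUj := hcol j (hns j hjs)
          rw [g4.2 _ ?_]
          · exact hUj i
          · intro a ha
            rw [hUj a, if_neg]
            rintro rfl
            exact hjs ha
    have : U = h * (g * U) := by rw [← mul_assoc, hhg, one_mul]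
    rw [this]
    exact mul_mem (hsub hh) hgU

/-- Every unitary `n×n` matrix (`n ≥ 2`) with entries in `𝔻[ω]` and determinant 1 is a
finite product of two-level unitary matrices of types `iX`, `T^{-m}(iH)T^m`, and `W`. -/
theorem stmt12 (n : ℕ) (hn : 2 ≤ n) (U : Matrix (Fin n) (Fin n) ℂ)
    (hU : U ∈ Matrix.unitaryGroup (Fin n) ℂ)
    (hent : ∀ i j, inDω (U i j)) (hdet : U.det = 1) :
    ∃ L : List (Matrix (Fin n) (Fin n) ℂ),
      (∀ M ∈ L, IsDet1Gen M) ∧ U = L.prod := by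
  have h := main_ind n U (Matrix.mem_unitaryGroup_iff'.1 hU) (fun i j => inD_mem (hent i j)) hdet
    (fun j hj => by omega)
  obtain ⟨L, hL, hp⟩ := Submonoid.exists_list_of_mem_closure h
  exact ⟨L, fun M hM => gens_det1 _ (hL M hM), hp.symm⟩
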